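/- arXiv:1304.8074 — 4 statements merged into one kernel-verified Lean document; each statement's English description precedes it below -/
import Mathlib

section
/- Let A ∈ S m and b ∈ S (m-1) be cells such that b is a free face of A, i.e. (∂A) b = 1 and (∂x) b = 0 for every x ∈ S m with x ≠ A. Then: (1) for every cell x other than A and b, the chain ∂x has zero coefficient at both A and b, so the chains supported on the cells other than A and b form a subcomplex of the cellular chain complex (with the restricted boundary maps, which coincide with the deleted boundary d'); and (2) the inclusion of this subcomplex induces an isomorphism on homology in every degree n. -/
noncomputable section

open LinearMap

variable (M M' : ℤ → Type) [∀ n, AddCommGroup (M n)] [∀ n, Module (ZMod 2) (M n)]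
  [∀ n, AddCommGroup (M' n)] [∀ n, Module (ZMod 2) (M' n)]

/-- Cast along an equality of degrees. -/
def mcast {n m : ℤ} (h : n = m) : M n ≃ₗ[ZMod 2] M m := by cases h; exact LinearEquiv.refl _ _

theorem mcast_comm (f : ∀ n, M n →ₗ[ZMod 2] M' n) {n m : ℤ} (h : n = m) (z : M n) :
    f m (mcast M h z) = mcast M' h (f n z) := by cases h; rfl

variable (D : ∀ n : ℤ, M n →ₗ[ZMod 2] M (n-1)) (D' : ∀ n : ℤ, M' n →ₗ[ZMod 2] M' (n-1))

/-- The cycles in degree `n`. -/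
def cycles (n : ℤ) : Submodule (ZMod 2) (M n) := LinearMap.ker (D n)

/-- The boundaries in degree `n`. -/
def bdries (n : ℤ) : Submodule (ZMod 2) (M n) :=
  (LinearMap.range (D (n+1))).map (mcast M (show n+1-1 = n by ring)).toLinearMap

/-- The homology in degree `n` : cycles modulo boundaries. -/
abbrev homology (n : ℤ) : Type _ :=
  cycles M D n ⧸ (bdries M D n).comap (cycles M D n).subtype

variable {M M'}

/-- A chain map between two complexes of graded modules. -/
def IsChainMap (f : ∀ n, M n →ₗ[ZMod 2] M' n) : Prop :=
  ∀ n : ℤ, (D' n).comp (f n) = (f (n-1)).comp (D n)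

variable {D D'}

/-- The map induced on cycles by a chain map. -/
def cyclesMap {f : ∀ n, M n →ₗ[ZMod 2] M' n} (hf : IsChainMap D D' f) (n : ℤ) :
    cycles M D n →ₗ[ZMod 2] cycles M' D' n :=
  (f n).restrict (p := cycles M D n) (q := cycles M' D' n) (fun x hx => by
    have h := LinearMap.ext_iff.mp (hf n) x
    simp only [LinearMap.comp_apply] at h
    simp only [cycles, LinearMap.mem_ker] at hx ⊢
    rw [h, hx, map_zero])

/-- The map induced on homology by a chain map. -/
def inducedHom {f : ∀ n, M n →ₗ[ZMod 2] M' n} (hf : IsChainMap D D' f) (n : ℤ) :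
    homology M D n →ₗ[ZMod 2] homology M' D' n :=
  Submodule.mapQ _ _ (cyclesMap hf n) (by
    rintro ⟨x, hx⟩ hmem
    simp only [Submodule.mem_comap, Submodule.subtype_apply] at hmem ⊢
    obtain ⟨y, ⟨c, rfl⟩, rfl⟩ := hmem
    refine ⟨D' (n+1) (f (n+1) c), ⟨f (n+1) c, rfl⟩, ?_⟩
    show _ = (cyclesMap hf n ⟨_, hx⟩ : M' n)
    have : (cyclesMap hf n ⟨_, hx⟩ : M' n) = f n (mcast M (show n+1-1 = n by ring) (D (n+1) c)) := rfl
    rw [this, mcast_comm (M := M) (M' := M') f]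
    have h2 := LinearMap.ext_iff.mp (hf (n+1)) c
    simp only [LinearMap.comp_apply] at h2
    exact congrArg _ h2)


variable (S : ℤ → Type) (d : ∀ n : ℤ, (S n →₀ ZMod 2) →ₗ[ZMod 2] (S (n-1) →₀ ZMod 2))

/-- Chains of the restricted complex: finitely supported functions on the cells satisfying `P`. -/
abbrev rCh (P : ∀ n : ℤ, S n → Prop) (n : ℤ) : Type := {x : S n // P n x} →₀ ZMod 2

/-- The boundary of the restricted complex: extend by zero, take the boundary, delete the
coefficients at the cells not satisfying `P`. -/
def resD (P : ∀ n : ℤ, S n → Prop) (n : ℤ) : rCh S P n →ₗ[ZMod 2] rCh S P (n-1) :=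
  (Finsupp.lsubtypeDomain (R := ZMod 2) {x : S (n-1) | P (n-1) x}).comp
    ((d n).comp (Finsupp.lmapDomain (ZMod 2) (ZMod 2) Subtype.val))

/-- Deletion: restrict a chain to the cells satisfying `P`. -/
def delMap (P : ∀ n : ℤ, S n → Prop) (n : ℤ) : (S n →₀ ZMod 2) →ₗ[ZMod 2] rCh S P n :=
  Finsupp.lsubtypeDomain (R := ZMod 2) {x : S n | P n x}

/-- Inclusion: extend a chain on the cells satisfying `P` by zero. -/
def inclMap (P : ∀ n : ℤ, S n → Prop) (n : ℤ) : rCh S P n →ₗ[ZMod 2] (S n →₀ ZMod 2) :=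
  Finsupp.lmapDomain (ZMod 2) (ZMod 2) Subtype.val

/-- Inclusion between restricted complexes. -/
def resIncl {P Q : ∀ n : ℤ, S n → Prop} (h : ∀ n x, P n x → Q n x) (n : ℤ) :
    rCh S P n →ₗ[ZMod 2] rCh S Q n :=
  Finsupp.lmapDomain (ZMod 2) (ZMod 2) (fun x => ⟨x.1, h n x.1 x.2⟩)

/-- The cells different from the two given cells `A ∈ S m` and `b ∈ S (m-1)`. -/
def offPair (m : ℤ) (A : S m) (b : S (m-1)) : ∀ n : ℤ, S n → Prop :=
  fun n x => (⟨n, x⟩ : Σ k, S k) ≠ ⟨m, A⟩ ∧ (⟨n, x⟩ : Σ k, S k) ≠ ⟨m - 1, b⟩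


end

theorem ffc_F (S : ℤ → Type)
    (d : ∀ n : ℤ, (S n →₀ ZMod 2) →ₗ[ZMod 2] (S (n-1) →₀ ZMod 2))
    (m : ℤ) (A : S m) (b : S (m-1))
    (hAb : (d m (Finsupp.single A 1)) b = 1)
    (hfree : ∀ x : S m, x ≠ A → (d m (Finsupp.single x 1)) b = 0)
    (z : S m →₀ ZMod 2) : (d m z) b = z A := by
  have : (Finsupp.lapply (R := ZMod 2) (M := ZMod 2) b).comp (d m) = Finsupp.lapply (R := ZMod 2) A := by
    apply Finsupp.lhom_ext'
    intro x
    apply LinearMap.ext_ring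
    by_cases hx : x = A
    · subst hx; simp [hAb]
    · simp [hfree x hx, Finsupp.single_apply, hx]
  exact LinearMap.congr_fun this z

theorem ffc_G (S : ℤ → Type)
    (d : ∀ n : ℤ, (S n →₀ ZMod 2) →ₗ[ZMod 2] (S (n-1) →₀ ZMod 2))
    (hd : ∀ n : ℤ, (d (n-1)).comp (d n) = 0)
    (m : ℤ) (A : S m) (b : S (m-1))
    (hAb : (d m (Finsupp.single A 1)) b = 1)
    (hfree : ∀ x : S m, x ≠ A → (d m (Finsupp.single x 1)) b = 0)
    (n : ℤ) (h : n - 1 = m) (z : S n →₀ ZMod 2) :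
    (mcast (fun k => S k →₀ ZMod 2) h (d n z)) A = 0 := by
  subst h
  change (d n z) A = 0
  rw [← ffc_F S d _ A b hAb hfree]
  have := LinearMap.congr_fun (hd n) z
  simp only [LinearMap.comp_apply] at this
  rw [this]; rfl

theorem ffc_vanish (S : ℤ → Type) (P : ∀ n : ℤ, S n → Prop) (n : ℤ) (c : rCh S P n)
    (x : S n) (hx : ¬ P n x) : inclMap S P n c x = 0 := by
  refine Finsupp.mapDomain_of_notMem_range _ _ ?_
  rintro ⟨y, rfl⟩
  exact hx y.2

theorem ffc_incl_del (S : ℤ → Type) (P : ∀ n : ℤ, S n → Prop) (n : ℤ) (z : S n →₀ ZMod 2)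
    (hz : ∀ x, ¬ P n x → z x = 0) : inclMap S P n (delMap S P n z) = z := by
  ext x
  by_cases hx : P n x
  · exact Finsupp.mapDomain_apply Subtype.val_injective _ (⟨x, hx⟩ : {x // P n x})
  · rw [hz x hx, ffc_vanish S P n _ x hx]

theorem ffc_incl_inj (S : ℤ → Type) (P : ∀ n : ℤ, S n → Prop) (n : ℤ) :
    Function.Injective (inclMap S P n) :=
  Finsupp.mapDomain_injective Subtype.val_injective

theorem ffc_cast (S : ℤ → Type) (m : ℤ) (A : S m) (n k : ℤ) (h : n = k) (z : S n →₀ ZMod 2)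
    (y : S n) (hy : (⟨n, y⟩ : Σ k, S k) = ⟨m, A⟩) (h' : n = m) :
    z y = mcast (fun k => S k →₀ ZMod 2) h' z A := by
  subst h'
  obtain rfl : y = A := by simpa using hy
  rfl

theorem ffc_dvanish (S : ℤ → Type)
    (d : ∀ n : ℤ, (S n →₀ ZMod 2) →ₗ[ZMod 2] (S (n-1) →₀ ZMod 2))
    (hd : ∀ n : ℤ, (d (n-1)).comp (d n) = 0)
    (m : ℤ) (A : S m) (b : S (m-1))
    (hAb : (d m (Finsupp.single A 1)) b = 1)
    (hfree : ∀ x : S m, x ≠ A → (d m (Finsupp.single x 1)) b = 0)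
    (n : ℤ) (z : S n →₀ ZMod 2) (hz : ∀ x, ¬ offPair S m A b n x → z x = 0)
    (y : S (n-1)) (hy : ¬ offPair S m A b (n-1) y) : d n z y = 0 := by
  unfold offPair at hy
  rw [not_and_or, not_not, not_not] at hy
  rcases hy with hy | hy
  · have h : n - 1 = m := congrArg Sigma.fst hy
    rw [ffc_cast S m A (n-1) m h _ y hy h]
    exact ffc_G S d hd m A b hAb hfree n h z
  · have h : n - 1 = m - 1 := congrArg Sigma.fst hy
    obtain rfl : n = m := by omega
    obtain rfl : y = b := by simpa using hy
    rw [ffc_F S d _ A y hAb hfree]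
    exact hz A (fun h => h.1 rfl)

theorem ffc_bd (M : ℤ → Type) [∀ n, AddCommGroup (M n)] [∀ n, Module (ZMod 2) (M n)]
    (D : ∀ n : ℤ, M n →ₗ[ZMod 2] M (n-1)) (n k : ℤ) (h : n - 1 = k) (a : M n) :
    mcast M h (D n a) ∈ bdries M D k := by
  obtain rfl : n = k + 1 := by omega
  exact ⟨_, ⟨a, rfl⟩, rfl⟩

theorem ffc_bd_ker (M : ℤ → Type) [∀ n, AddCommGroup (M n)] [∀ n, Module (ZMod 2) (M n)]
    (D : ∀ n : ℤ, M n →ₗ[ZMod 2] M (n-1)) (hD : ∀ n : ℤ, (D (n-1)).comp (D n) = 0)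
    (k : ℤ) (w : M k) (hw : w ∈ bdries M D k) : D k w = 0 := by
  obtain ⟨_, ⟨a, rfl⟩, rfl⟩ := hw
  have key : ∀ (n k : ℤ) (h : n - 1 = k) (a : M n), D k (mcast M h (D n a)) = 0 := by
    intro n k h a
    subst h
    exact LinearMap.congr_fun (hD n) a
  exact key _ _ _ a

theorem ffc_core (S : ℤ → Type)
    (d : ∀ n : ℤ, (S n →₀ ZMod 2) →ₗ[ZMod 2] (S (n-1) →₀ ZMod 2))
    (m : ℤ) (A : S m) (b : S (m-1))
    (hAb : (d m (Finsupp.single A 1)) b = 1)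
    (hfree : ∀ x : S m, x ≠ A → (d m (Finsupp.single x 1)) b = 0)
    (n : ℤ) (w : S n →₀ ZMod 2)
    (hw : ∀ y, ¬ offPair S m A b (n-1) y → d n w y = 0) :
    ∃ w' : S n →₀ ZMod 2, (∀ x, ¬ offPair S m A b n x → w' x = 0) ∧
      w' - w ∈ bdries (fun k => S k →₀ ZMod 2) d n := by
  by_cases hn : n = m - 1
  · subst hn
    refine ⟨w - w b • d m (Finsupp.single A 1), ?_, ?_⟩
    · intro x hx
      unfold offPair at hx
      rw [not_and_or, not_not, not_not] at hx
      rcases hx with hx | hx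
      · have h : m - 1 = m := congrArg Sigma.fst hx
        omega
      · obtain rfl : x = b := by simpa using hx
        simp [hAb]
    · have : w - w b • d m (Finsupp.single A 1) - w = -(w b • d m (Finsupp.single A 1)) := by abel
      rw [this]
      exact Submodule.neg_mem _ (Submodule.smul_mem _ _
        (ffc_bd (fun k => S k →₀ ZMod 2) d m (m-1) rfl (Finsupp.single A 1)))
  · refine ⟨w, ?_, by rw [sub_self]; exact Submodule.zero_mem _⟩
    intro x hx
    unfold offPair at hx
    rw [not_and_or, not_not, not_not] at hx
    rcases hx with hx | hx
    · have h : n = m := congrArg Sigma.fst hx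
      subst h
      obtain rfl : x = A := by simpa using hx
      rw [← ffc_F S d _ x b hAb hfree]
      exact hw b (fun h => h.2 rfl)
    · exact absurd (congrArg Sigma.fst hx) hn

/-- If `b` is a free face of `A`, then (1) no boundary of a remaining cell involves `A` or `b`,
so the chains on the remaining cells form a subcomplex (the inclusion is a chain map with respect
to the deleted boundary `d' = resD`), and (2) this inclusion induces an isomorphism on homology
in every degree. -/
theorem free_face_collapse_homology
    (S : ℤ → Type)
    (d : ∀ n : ℤ, (S n →₀ ZMod 2) →ₗ[ZMod 2] (S (n-1) →₀ ZMod 2))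
    (hd : ∀ n : ℤ, (d (n-1)).comp (d n) = 0)
    (m : ℤ) (A : S m) (b : S (m-1))
    (hAb : (d m (Finsupp.single A 1)) b = 1)
    (hfree : ∀ x : S m, x ≠ A → (d m (Finsupp.single x 1)) b = 0) :
    (∀ (n : ℤ) (x : S n),
        (⟨n, x⟩ : Σ k, S k) ≠ ⟨m, A⟩ → (⟨n, x⟩ : Σ k, S k) ≠ ⟨m - 1, b⟩ →
        (∀ h : n - 1 = m,
          (mcast (fun k => S k →₀ ZMod 2) h (d n (Finsupp.single x 1))) A = 0) ∧
        (∀ h : n - 1 = m - 1,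
          (mcast (fun k => S k →₀ ZMod 2) h (d n (Finsupp.single x 1))) b = 0)) ∧
    ∃ hcm : IsChainMap (resD S d (offPair S m A b)) d (inclMap S (offPair S m A b)),
      ∀ n : ℤ, Function.Bijective (inducedHom hcm n) := by
  refine ⟨?_, ?_⟩
  · intro n x h1 h2
    refine ⟨fun h => ffc_G S d hd m A b hAb hfree n h _, fun h => ?_⟩
    obtain rfl : n = m := by omega
    exact hfree x (fun hx => h1 (by rw [hx]))
  have hcm : IsChainMap (resD S d (offPair S m A b)) d (inclMap S (offPair S m A b)) := by
    intro n
    apply LinearMap.ext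
    intro c
    exact (ffc_incl_del S _ _ _ (ffc_dvanish S d hd m A b hAb hfree n _
      (fun x hx => ffc_vanish S _ n c x hx))).symm
  have hcm' : ∀ n c, d n (inclMap S (offPair S m A b) n c) =
      inclMap S (offPair S m A b) (n-1) (resD S d (offPair S m A b) n c) :=
    fun n c => LinearMap.congr_fun (hcm n) c
  refine ⟨hcm, fun n => ⟨?_, ?_⟩⟩
  · rw [← LinearMap.ker_eq_bot, LinearMap.ker_eq_bot']
    intro q hq
    obtain ⟨⟨c, hc⟩, rfl⟩ := Submodule.mkQ_surjective _ q
    have hq' := (Submodule.Quotient.mk_eq_zero _).1 hq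
    refine (Submodule.Quotient.mk_eq_zero _).2 ?_
    change inclMap S (offPair S m A b) n c ∈ bdries _ d n at hq'
    change c ∈ bdries _ _ n
    obtain ⟨_, ⟨w, rfl⟩, hw⟩ := hq'
    have key : ∀ (k : ℤ) (h : k - 1 = n) (w : S k →₀ ZMod 2),
        mcast (fun k => S k →₀ ZMod 2) h (d k w) = inclMap S (offPair S m A b) n c →
        c ∈ bdries _ (resD S d (offPair S m A b)) n := by
      clear hw w
      intro k h w hw
      subst h
      change d k w = _ at hw
      obtain ⟨w', hw', hb⟩ := ffc_core S d m A b hAb hfree k w (fun y hy => by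
        rw [hw]; exact ffc_vanish S _ _ c y hy)
      have h0 := ffc_bd_ker _ d hd k _ hb
      rw [map_sub, sub_eq_zero] at h0
      have : c = resD S d (offPair S m A b) k (delMap S (offPair S m A b) k w') := by
        apply ffc_incl_inj
        rw [← hcm', ffc_incl_del S _ _ _ hw', h0, hw]
      rw [this]
      exact ffc_bd _ (resD S d (offPair S m A b)) k (k-1) rfl _
    exact key _ _ w hw
  · intro q
    obtain ⟨⟨z, hz⟩, rfl⟩ := Submodule.mkQ_surjective _ q
    have hz0 : d n z = 0 := hz
    obtain ⟨w', hw', hb⟩ := ffc_core S d m A b hAb hfree n z (fun y hy => by rw [hz0]; rfl)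
    have h0 := ffc_bd_ker _ d hd n _ hb
    rw [map_sub, sub_eq_zero, hz0] at h0
    have hi := ffc_incl_del S _ _ _ hw'
    have hc : delMap S (offPair S m A b) n w' ∈ cycles _ (resD S d (offPair S m A b)) n := by
      change resD S d (offPair S m A b) n _ = 0
      apply ffc_incl_inj
      rw [← hcm', hi, h0, map_zero]
    refine ⟨Submodule.Quotient.mk ⟨_, hc⟩, ?_⟩
    refine (Submodule.Quotient.eq _).2 ?_
    change inclMap S (offPair S m A b) n (delMap S (offPair S m A b) n w') - z ∈ bdries _ d n
    rw [hi]
    exact hb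
end

section
/- Coreduction preserves homology: Let A ∈ S m and b ∈ S (m-1) be cells forming a coreduction pair, i.e. ∂A = Finsupp.single b 1. Then the deletion maps (which send a chain to its restriction to the cells other than A and b) form a chain map from the cellular chain complex K to the reduced complex K∖{A,b}, and this chain map induces an isomorphism on homology in every degree n. -/
theorem mcast_D_zero {M : ℤ → Type} [∀ n, AddCommGroup (M n)] [∀ n, Module (ZMod 2) (M n)]
    (D : ∀ n : ℤ, M n →ₗ[ZMod 2] M (n-1)) {n k : ℤ} (h : n = k) (x : M n) (hx : D n x = 0) :
    D k (mcast M h x) = 0 := by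
  cases h; exact hx

theorem mcast_mcast {M : ℤ → Type} [∀ n, AddCommGroup (M n)] [∀ n, Module (ZMod 2) (M n)]
    {n k : ℤ} (h : n = k) (h' : k = n) (x : M n) :
    mcast M h' (mcast M h x) = x := by
  cases h; rfl

theorem bij_of_acyclic {M M' : ℤ → Type} [∀ n, AddCommGroup (M n)] [∀ n, Module (ZMod 2) (M n)]
    [∀ n, AddCommGroup (M' n)] [∀ n, Module (ZMod 2) (M' n)]
    {D : ∀ n : ℤ, M n →ₗ[ZMod 2] M (n-1)} {D' : ∀ n : ℤ, M' n →ₗ[ZMod 2] M' (n-1)}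
    {f : ∀ n, M n →ₗ[ZMod 2] M' n} (hf : IsChainMap D D' f)
    (hd : ∀ n : ℤ, (D (n-1)).comp (D n) = 0)
    (hs : ∀ n, Function.Surjective (f n))
    (hac : ∀ n (x : M (n-1)), f (n-1) x = 0 → D (n-1) x = 0 → ∃ y : M n, f n y = 0 ∧ D n y = x)
    (n : ℤ) : Function.Bijective (inducedHom hf n) := by
  have hf' : ∀ n x, D' n (f n x) = f (n-1) (D n x) := fun n x => LinearMap.ext_iff.mp (hf n) x
  have hd' : ∀ n x, D (n-1) (D n x) = 0 := fun n x => LinearMap.ext_iff.mp (hd n) x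
  constructor
  · rw [injective_iff_map_eq_zero]
    intro z hz
    obtain ⟨⟨z, hzc⟩, rfl⟩ := Submodule.Quotient.mk_surjective _ z
    have hz2 : f n z ∈ bdries M' D' n := by
      have := (Submodule.Quotient.mk_eq_zero _).1 hz
      exact this
    obtain ⟨_, ⟨w, rfl⟩, hw⟩ := hz2
    obtain ⟨w, rfl⟩ := hs _ w
    have e1 : n + 1 - 1 = n := by ring
    have hw : mcast M' e1 (D' (n+1) (f (n+1) w)) = f n z := hw
    have hzc : D n z = 0 := hzc
    rw [hf', ← mcast_comm M M' f] at hw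
    obtain ⟨y, -, hy⟩ := hac (n+1) (mcast M e1.symm (z - mcast M e1 (D (n+1) w)))
      (by rw [mcast_comm M M' f, map_sub, hw, sub_self, map_zero])
      (mcast_D_zero D _ _ (by rw [map_sub, hzc, mcast_D_zero D _ _ (hd' _ _), sub_zero]))
    refine (Submodule.Quotient.mk_eq_zero _).2 ?_
    refine ⟨D (n+1) (y + w), ⟨_, rfl⟩, ?_⟩
    show mcast M e1 (D (n+1) (y + w)) = z
    rw [map_add, map_add, hy, mcast_mcast, sub_add_cancel]
  · intro z
    obtain ⟨⟨z, hzc⟩, rfl⟩ := Submodule.Quotient.mk_surjective _ z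
    obtain ⟨z, rfl⟩ := hs _ z
    have h0 : D' n (f n z) = 0 := hzc
    rw [hf'] at h0
    obtain ⟨y, hy, hy'⟩ := hac n (D n z) h0 (hd' _ _)
    refine ⟨Submodule.Quotient.mk ⟨z - y, ?_⟩, ?_⟩
    · show D n (z - y) = 0
      rw [map_sub, hy', sub_self]
    · show Submodule.Quotient.mk (cyclesMap hf n _) = _
      congr 1
      apply Subtype.ext
      show f n (z - y) = f n z
      rw [map_sub, hy, sub_zero]

theorem delMap_incl (S : ℤ → Type) (P : ∀ n : ℤ, S n → Prop) (n : ℤ) (x : rCh S P n) :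
    delMap S P n (inclMap S P n x) = x := by
  ext y
  exact Finsupp.mapDomain_apply Subtype.val_injective x y

theorem delMap_zero (S : ℤ → Type) (P : ∀ n : ℤ, S n → Prop) (n : ℤ) (x : S n →₀ ZMod 2)
    (h : delMap S P n x = 0) (y : S n) (hy : P n y) : x y = 0 :=
  DFunLike.congr_fun h (⟨y, hy⟩ : {x : S n // P n x})

theorem ker_cases (S : ℤ → Type) (m : ℤ) (A : S m) (b : S (m-1)) (n : ℤ) (x : S n →₀ ZMod 2)
    (h : delMap S (offPair S m A b) n x = 0) :
    (∃ (e : n = m) (c : ZMod 2), x = Finsupp.single (e ▸ A) c) ∨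
    (∃ (e : n = m - 1) (c : ZMod 2), x = Finsupp.single (e ▸ b) c) ∨ x = 0 := by
  have h := delMap_zero S _ n x h
  by_cases e : n = m
  · subst e
    refine Or.inl ⟨rfl, x A, ?_⟩
    ext y
    by_cases hy : y = A
    · subst hy; simp
    · rw [Finsupp.single_eq_of_ne hy]
      refine h y ⟨fun hh => hy (by simpa using hh), fun hh => ?_⟩
      have : n = n - 1 := congrArg Sigma.fst hh
      omega
  by_cases e' : n = m - 1
  · subst e'
    refine Or.inr (Or.inl ⟨rfl, x b, ?_⟩)
    ext y
    by_cases hy : y = b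
    · subst hy; simp
    · rw [Finsupp.single_eq_of_ne hy]
      refine h y ⟨fun hh => e (congrArg Sigma.fst hh), fun hh => hy (by simpa using hh)⟩
  · refine Or.inr (Or.inr ?_)
    ext y
    exact h y ⟨fun hh => e (congrArg Sigma.fst hh), fun hh => e' (congrArg Sigma.fst hh)⟩

theorem delMap_A (S : ℤ → Type) (m : ℤ) (A : S m) (b : S (m-1)) (c : ZMod 2) :
    delMap S (offPair S m A b) m (Finsupp.single A c) = 0 := by
  ext ⟨y, hy⟩
  show Finsupp.single A c y = 0
  exact Finsupp.single_eq_of_ne (fun h => hy.1 (by rw [h]))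

theorem delMap_b (S : ℤ → Type) (m : ℤ) (A : S m) (b : S (m-1)) (c : ZMod 2) :
    delMap S (offPair S m A b) (m-1) (Finsupp.single b c) = 0 := by
  ext ⟨y, hy⟩
  show Finsupp.single b c y = 0
  exact Finsupp.single_eq_of_ne (fun h => hy.2 (by rw [h]))

/-- Coreduction preserves homology: if `(A, b)` is a coreduction pair then the deletion maps form
a chain map from `K` to the reduced complex `K∖{A,b}` which induces an isomorphism on homology in
every degree. -/
theorem coreduction_homology_iso
    (S : ℤ → Type)
    (d : ∀ n : ℤ, (S n →₀ ZMod 2) →ₗ[ZMod 2] (S (n-1) →₀ ZMod 2))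
    (hd : ∀ n : ℤ, (d (n-1)).comp (d n) = 0)
    (m : ℤ) (A : S m) (b : S (m-1))
    (hAb : d m (Finsupp.single A 1) = Finsupp.single b 1) :
    ∃ hcm : IsChainMap d (resD S d (offPair S m A b)) (delMap S (offPair S m A b)),
      ∀ n : ℤ, Function.Bijective (inducedHom hcm n) := by
  have hA : ∀ c : ZMod 2, d m (Finsupp.single A c) = Finsupp.single b c := by
    intro c
    have := congrArg (fun t => c • t) hAb
    simpa [← map_smul] using this
  have hdd : ∀ n x, d (n-1) (d n x) = 0 := fun n x => LinearMap.ext_iff.mp (hd n) x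
  have hb : ∀ c : ZMod 2, d (m-1) (Finsupp.single b c) = 0 := by
    intro c; rw [← hA, hdd]
  have hker : ∀ n (x : S n →₀ ZMod 2), delMap S (offPair S m A b) n x = 0 →
      delMap S (offPair S m A b) (n-1) (d n x) = 0 := by
    intro n x hx
    rcases ker_cases S m A b n x hx with ⟨e, c, rfl⟩ | ⟨e, c, rfl⟩ | rfl
    · subst e
      show delMap S _ _ (d n (Finsupp.single A c)) = 0
      rw [hA, delMap_b]
    · subst e
      show delMap S _ _ (d (m-1) (Finsupp.single b c)) = 0
      rw [hb, map_zero]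
    · rw [map_zero, map_zero]
  have hcm : IsChainMap d (resD S d (offPair S m A b)) (delMap S (offPair S m A b)) := by
    intro n
    refine LinearMap.ext fun x => ?_
    show delMap S (offPair S m A b) (n-1) (d n (inclMap S _ n (delMap S _ n x))) =
      delMap S (offPair S m A b) (n-1) (d n x)
    rw [← sub_eq_zero, ← map_sub, ← map_sub]
    apply hker
    rw [map_sub, delMap_incl, sub_self]
  refine ⟨hcm, bij_of_acyclic hcm hd (fun n x => ⟨_, delMap_incl S _ n x⟩) ?_⟩
  intro n x hx hdx
  rcases ker_cases S m A b (n-1) x hx with ⟨e, c, rfl⟩ | ⟨e, c, rfl⟩ | rfl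
  · subst e
    have h1 : d (n-1) (Finsupp.single A c) = 0 := hdx
    rw [hA, Finsupp.single_eq_zero] at h1
    subst h1
    exact ⟨0, map_zero _, by simp⟩
  · obtain rfl : n = m := by omega
    exact ⟨Finsupp.single A c, delMap_A S n A b c, hA c⟩
  · exact ⟨0, map_zero _, map_zero _⟩
end

section
/- Coreductions preserve persistent homology: Let g be a filtration of the cellular chain complex, and let A ∈ S m and b ∈ S (m-1) be cells forming a coreduction pair, i.e. ∂A = Finsupp.single b 1, with g(A) = g(b). Then for every degree n and all i ≤ j, the degree-n persistent homology H_n^{i,j} of the filtered complex K is isomorphic as a ZMod 2-module to the degree-n persistent homology H_n^{i,j} of the reduced filtered complex K∖{A,b} (filtered by the restriction of g). -/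
noncomputable section

open LinearMap

variable (M M' : ℤ → Type) [∀ n, AddCommGroup (M n)] [∀ n, Module (ZMod 2) (M n)]
  [∀ n, AddCommGroup (M' n)] [∀ n, Module (ZMod 2) (M' n)]

variable (D : ∀ n : ℤ, M n →ₗ[ZMod 2] M (n-1)) (D' : ∀ n : ℤ, M' n →ₗ[ZMod 2] M' (n-1))

variable {M M'}

variable {D D'}

variable (S : ℤ → Type) (d : ∀ n : ℤ, (S n →₀ ZMod 2) →ₗ[ZMod 2] (S (n-1) →₀ ZMod 2))

/-- The sublevel predicate of a filtration `g` at level `t`. -/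
def subl (g : ∀ n : ℤ, S n → ℤ) (t : ℤ) : ∀ n : ℤ, S n → Prop := fun n x => g n x ≤ t

/-- Sublevel predicate of the reduced complex `K∖{A,b}` at level `t`. -/
def offSubl (m : ℤ) (A : S m) (b : S (m-1)) (g : ∀ n : ℤ, S n → ℤ) (t : ℤ) :
    ∀ n : ℤ, S n → Prop := fun n x => offPair S m A b n x ∧ g n x ≤ t

end

section Helpers

theorem single_one_ind {α : Type} {N : Type} [AddCommGroup N] [Module (ZMod 2) N]
    (φ ψ : (α →₀ ZMod 2) →ₗ[ZMod 2] N)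
    (h : ∀ a, φ (Finsupp.single a 1) = ψ (Finsupp.single a 1)) : φ = ψ := by
  refine Finsupp.lhom_ext' fun a => LinearMap.ext_ring ?_
  simpa using h a

theorem zmod2_eq (r : ZMod 2) (h : r ≠ 0) : r = 1 := by revert r; decide

theorem mem_bdries_iff {M : ℤ → Type} [∀ n, AddCommGroup (M n)] [∀ n, Module (ZMod 2) (M n)]
    (D : ∀ n : ℤ, M n →ₗ[ZMod 2] M (n-1)) (n : ℤ) (x : M n) :
    x ∈ bdries M D n ↔ ∃ c, mcast M (show n+1-1 = n by ring) (D (n+1) c) = x := by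
  simp only [bdries, Submodule.mem_map, LinearMap.mem_range]
  constructor
  · rintro ⟨_, ⟨c, rfl⟩, h⟩
    exact ⟨c, h⟩
  · rintro ⟨c, h⟩
    exact ⟨_, ⟨c, rfl⟩, h⟩

theorem D_mcast {M : ℤ → Type} [∀ n, AddCommGroup (M n)] [∀ n, Module (ZMod 2) (M n)]
    (D : ∀ n : ℤ, M n →ₗ[ZMod 2] M (n-1)) {k n : ℤ} (h : k = n) (x : M k) :
    D k x = 0 → D n (mcast M h x) = 0 := by
  subst h; exact id

theorem mcast_acyc {M M' : ℤ → Type} [∀ n, AddCommGroup (M n)] [∀ n, Module (ZMod 2) (M n)]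
    [∀ n, AddCommGroup (M' n)] [∀ n, Module (ZMod 2) (M' n)]
    (D : ∀ n : ℤ, M n →ₗ[ZMod 2] M (n-1))
    (f : ∀ n, M n →ₗ[ZMod 2] M' n)
    (H : ∀ n (x : M (n-1)), f (n-1) x = 0 → D (n-1) x = 0 → ∃ y, f n y = 0 ∧ D n y = x)
    {k n : ℤ} (h : k - 1 = n) (x : M n) (h1 : f n x = 0) (h2 : D n x = 0) :
    ∃ y, f k y = 0 ∧ mcast M h (D k y) = x := by
  subst h
  exact H k x h1 h2

theorem inducedHom_bij {M M' : ℤ → Type} [∀ n, AddCommGroup (M n)] [∀ n, Module (ZMod 2) (M n)]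
    [∀ n, AddCommGroup (M' n)] [∀ n, Module (ZMod 2) (M' n)]
    {D : ∀ n : ℤ, M n →ₗ[ZMod 2] M (n-1)} {D' : ∀ n : ℤ, M' n →ₗ[ZMod 2] M' (n-1)}
    (hD : ∀ n (x : M n), D (n-1) (D n x) = 0)
    {f : ∀ n, M n →ₗ[ZMod 2] M' n} (hf : IsChainMap D D' f)
    (hs : ∀ n, Function.Surjective (f n))
    (H : ∀ n (x : M (n-1)), f (n-1) x = 0 → D (n-1) x = 0 → ∃ y, f n y = 0 ∧ D n y = x)
    (n : ℤ) : Function.Bijective (inducedHom hf n) := by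
  have hf' : ∀ n x, D' n (f n x) = f (n-1) (D n x) := fun n x => LinearMap.ext_iff.mp (hf n) x
  constructor
  · rw [← LinearMap.ker_eq_bot, LinearMap.ker_eq_bot']
    intro q hq
    obtain ⟨⟨x, hx⟩, rfl⟩ := Submodule.Quotient.mk_surjective _ q
    have hx' : D n x = 0 := hx
    have hq' : (Submodule.Quotient.mk (cyclesMap hf n ⟨x, hx⟩) : homology M' D' n) = 0 := hq
    rw [Submodule.Quotient.mk_eq_zero] at hq' ⊢
    have hq2 : f n x ∈ bdries M' D' n := hq'
    show x ∈ bdries M D n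
    rw [mem_bdries_iff] at hq2 ⊢
    obtain ⟨c', hc'⟩ := hq2
    obtain ⟨c, rfl⟩ := hs _ c'
    rw [hf', ← mcast_comm M M' f] at hc'
    obtain ⟨y, hy, hy2⟩ := mcast_acyc D f H (show n+1-1 = n by ring)
      (x - mcast M (show n+1-1 = n by ring) (D (n+1) c)) (by rw [map_sub, hc', sub_self])
      (by rw [map_sub, hx', D_mcast D _ _ (hD _ _), sub_self])
    refine ⟨c + y, ?_⟩
    rw [map_add, map_add, hy2]; abel
  · intro q
    obtain ⟨⟨x, hx⟩, rfl⟩ := Submodule.Quotient.mk_surjective _ q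
    have hx' : D' n x = 0 := hx
    obtain ⟨z, rfl⟩ := hs _ x
    obtain ⟨y, hy, hy2⟩ := H n (D n z) (by rw [← hf', hx']) (hD _ _)
    refine ⟨Submodule.Quotient.mk ⟨z - y, ?_⟩, ?_⟩
    · show D n (z - y) = 0
      rw [map_sub, hy2, sub_self]
    · show (Submodule.Quotient.mk (cyclesMap hf n ⟨z - y, _⟩) : homology M' D' n) = _
      congr 1
      apply Subtype.ext
      show f n (z - y) = f n z
      rw [map_sub, hy, sub_zero]

theorem range_equiv {H1 H2 G1 G2 : Type} [AddCommGroup H1] [AddCommGroup H2] [AddCommGroup G1]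
    [AddCommGroup G2] [Module (ZMod 2) H1] [Module (ZMod 2) H2] [Module (ZMod 2) G1]
    [Module (ZMod 2) G2] (φ : H1 →ₗ[ZMod 2] H2) (ψ : G1 →ₗ[ZMod 2] G2)
    (e1 : H1 →ₗ[ZMod 2] G1) (e2 : H2 →ₗ[ZMod 2] G2) (h1 : Function.Bijective e1)
    (h2 : Function.Bijective e2) (h : ∀ x, e2 (φ x) = ψ (e1 x)) :
    Nonempty (LinearMap.range φ ≃ₗ[ZMod 2] LinearMap.range ψ) := by
  refine ⟨LinearEquiv.ofSubmodules (LinearEquiv.ofBijective e2 h2) _ _ ?_⟩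
  ext y
  simp only [Submodule.mem_map, LinearMap.mem_range]
  constructor
  · rintro ⟨_, ⟨x, rfl⟩, rfl⟩
    exact ⟨e1 x, (h x).symm⟩
  · rintro ⟨x, rfl⟩
    obtain ⟨x, rfl⟩ := h1.2 x
    exact ⟨_, ⟨x, rfl⟩, h x⟩

variable {S : ℤ → Type} {d : ∀ n : ℤ, (S n →₀ ZMod 2) →ₗ[ZMod 2] (S (n-1) →₀ ZMod 2)}

theorem resD_apply (P : ∀ n : ℤ, S n → Prop) (n : ℤ) (x : rCh S P n) (c) :
    resD S d P n x c = d n (inclMap S P n x) c.1 := rfl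

theorem incl_single (P : ∀ n : ℤ, S n → Prop) (n : ℤ) (a : {x : S n // P n x}) (r : ZMod 2) :
    inclMap S P n (Finsupp.single a r) = Finsupp.single a.1 r := by
  simp [inclMap, Finsupp.lmapDomain_apply, Finsupp.mapDomain_single]

theorem incl_apply (P : ∀ n : ℤ, S n → Prop) (n : ℤ) (x : rCh S P n) (c) :
    inclMap S P n x c.1 = x c := by
  simp only [inclMap, Finsupp.lmapDomain_apply]
  exact Finsupp.mapDomain_apply Subtype.val_injective _ _

theorem incl_apply_not (P : ∀ n : ℤ, S n → Prop) (n : ℤ) (x : rCh S P n) (c) (h : ¬ P n c) :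
    inclMap S P n x c = 0 := by
  simp only [inclMap, Finsupp.lmapDomain_apply]
  apply Finsupp.mapDomain_of_notMem_range
  rintro ⟨y, rfl⟩
  exact h y.2

theorem incl_inj (P : ∀ n : ℤ, S n → Prop) (n : ℤ) : Function.Injective (inclMap S P n) := by
  intro x y h
  ext c
  rw [← incl_apply, ← incl_apply, h]

theorem incl_resIncl {P Q : ∀ n : ℤ, S n → Prop} (h : ∀ n x, P n x → Q n x) (n : ℤ) (x) :
    inclMap S Q n (resIncl S h n x) = inclMap S P n x := by
  simp only [inclMap, resIncl, Finsupp.lmapDomain_apply, ← Finsupp.mapDomain_comp]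
  rfl

theorem chain_incl {P Q : ∀ n : ℤ, S n → Prop} (h : ∀ n x, P n x → Q n x)
    (hc : ∀ n x c, P n x → Q (n-1) c → d n (Finsupp.single x 1) c ≠ 0 → P (n-1) c) :
    IsChainMap (resD S d P) (resD S d Q) (resIncl S h) := by
  intro n
  refine single_one_ind _ _ fun a => ?_
  simp only [LinearMap.comp_apply]
  ext c
  rw [resD_apply, incl_resIncl, ← incl_apply, incl_resIncl]
  by_cases hP : P (n-1) c.1
  · rw [incl_apply _ _ _ ⟨c.1, hP⟩, resD_apply]
  · rw [incl_apply_not _ _ _ _ hP, incl_single]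
    by_contra h0
    exact hP (hc n a.1 c.1 a.2 c.2 h0)

theorem incl_resD {P : ∀ n : ℤ, S n → Prop}
    (hc : ∀ n x c, P n x → d n (Finsupp.single x 1) c ≠ 0 → P (n-1) c) (n : ℤ) (x) :
    inclMap S P (n-1) (resD S d P n x) = d n (inclMap S P n x) := by
  suffices h : (inclMap S P (n-1)).comp (resD S d P n) = (d n).comp (inclMap S P n) from
    LinearMap.ext_iff.mp h x
  refine single_one_ind _ _ fun a => ?_
  simp only [LinearMap.comp_apply]
  ext c
  by_cases hP : P (n-1) c
  · rw [incl_apply _ _ _ ⟨c, hP⟩, resD_apply]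
  · rw [incl_apply_not _ _ _ _ hP, incl_single]
    by_contra h0
    exact hP (hc n a.1 c a.2 (Ne.symm h0))

/-- Deletion from the sublevel complex `P` to a smaller one. -/
noncomputable def delt (P Q : ∀ n : ℤ, S n → Prop) (n : ℤ) : rCh S P n →ₗ[ZMod 2] rCh S Q n :=
  (delMap S Q n).comp (inclMap S P n)

theorem delt_apply (P Q : ∀ n : ℤ, S n → Prop) (n : ℤ) (x : rCh S P n) (c) :
    delt P Q n x c = inclMap S P n x c.1 := rfl

theorem delt_incl {P Q : ∀ n : ℤ, S n → Prop} (h : ∀ n x, Q n x → P n x) (n : ℤ) (x) :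
    delt P Q n (resIncl S h n x) = x := by
  ext c
  rw [delt_apply, incl_resIncl, incl_apply]

theorem incl_delt_single {P Q : ∀ n : ℤ, S n → Prop} (n : ℤ) (a) (h : Q n a.1) :
    inclMap S Q n (delt P Q n (Finsupp.single a 1)) = Finsupp.single a.1 1 := by
  have : delt P Q n (Finsupp.single a 1) = Finsupp.single ⟨a.1, h⟩ 1 := by
    classical
    ext c
    rw [delt_apply, incl_single, Finsupp.single_apply, Finsupp.single_apply]
    simp [Subtype.ext_iff]
  rw [this, incl_single]

theorem delt_single_not {P Q : ∀ n : ℤ, S n → Prop} (n : ℤ) (a) (h : ¬ Q n a.1) :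
    delt P Q n (Finsupp.single a 1) = 0 := by
  classical
  ext c
  rw [delt_apply, incl_single, Finsupp.single_apply, if_neg]
  · rfl
  · intro e
    exact h (e ▸ c.2)

theorem chain_delt {P Q : ∀ n : ℤ, S n → Prop} (h : ∀ n x, Q n x → P n x)
    (hc : ∀ n x c, P n x → ¬ Q n x → Q (n-1) c → d n (Finsupp.single x 1) c = 0) :
    IsChainMap (resD S d P) (resD S d Q) (delt P Q) := by
  intro n
  refine single_one_ind _ _ fun a => ?_
  simp only [LinearMap.comp_apply]
  ext c
  rw [resD_apply, delt_apply, incl_apply _ _ _ ⟨c.1, h _ _ c.2⟩, resD_apply, incl_single]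
  by_cases hQ : Q n a.1
  · rw [incl_delt_single n a hQ]
  · rw [delt_single_not n a hQ, map_zero, map_zero, hc n a.1 c.1 a.2 hQ c.2]; rfl

theorem delt_comm {P P' Q Q' : ∀ n : ℤ, S n → Prop} (h : ∀ n x, P n x → P' n x)
    (h' : ∀ n x, Q n x → Q' n x) (h1 : ∀ n x, Q n x → P n x)
    (h2 : ∀ n x, Q' n x → P n x → Q n x) (n : ℤ) (x) :
    delt P' Q' n (resIncl S h n x) = resIncl S h' n (delt P Q n x) := by
  ext c
  rw [delt_apply, incl_resIncl, ← incl_apply, incl_resIncl]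
  by_cases hci : P n c.1
  · rw [incl_apply Q n _ ⟨c.1, h2 _ _ c.2 hci⟩, delt_apply]
  · rw [incl_apply_not _ _ _ _ hci, incl_apply_not]
    exact fun h => hci (h1 _ _ h)

end Helpers

/-- Coreductions preserve persistent homology: if `(A, b)` is a coreduction pair with
`g A = g b`, then the persistent homology of the filtered complex `K` agrees with that of the
reduced filtered complex `K∖{A,b}` in every degree. -/
theorem coreduction_persistence
    (S : ℤ → Type)
    (d : ∀ n : ℤ, (S n →₀ ZMod 2) →ₗ[ZMod 2] (S (n-1) →₀ ZMod 2))
    (hd : ∀ n : ℤ, (d (n-1)).comp (d n) = 0)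
    (g : ∀ n : ℤ, S n → ℤ)
    (hg : ∀ (n : ℤ) (a : S n) (c : S (n-1)),
      (d n (Finsupp.single a 1)) c ≠ 0 → g (n-1) c ≤ g n a)
    (m : ℤ) (A : S m) (b : S (m-1))
    (hAb : d m (Finsupp.single A 1) = Finsupp.single b 1)
    (hgAb : g m A = g (m-1) b) :
    ∃ (hK : ∀ (i j : ℤ) (hij : i ≤ j),
        IsChainMap (resD S d (subl S g i)) (resD S d (subl S g j))
          (resIncl S (P := subl S g i) (Q := subl S g j) (fun _ _ hx => le_trans hx hij)))
      (hR : ∀ (i j : ℤ) (hij : i ≤ j),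
        IsChainMap (resD S d (offSubl S m A b g i)) (resD S d (offSubl S m A b g j))
          (resIncl S (P := offSubl S m A b g i) (Q := offSubl S m A b g j)
            (fun _ _ hx => ⟨hx.1, le_trans hx.2 hij⟩))),
      ∀ (n i j : ℤ) (hij : i ≤ j),
        Nonempty ((LinearMap.range (inducedHom (hK i j hij) n)) ≃ₗ[ZMod 2]
          (LinearMap.range (inducedHom (hR i j hij) n))) := by
  have hdb : d (m-1) (Finsupp.single b 1) = 0 := by
    rw [← hAb]; exact LinearMap.ext_iff.mp (hd m) _
  have hK : ∀ (i j : ℤ) (hij : i ≤ j),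
        IsChainMap (resD S d (subl S g i)) (resD S d (subl S g j))
          (resIncl S (P := subl S g i) (Q := subl S g j) (fun _ _ hx => le_trans hx hij)) :=
    fun i j hij => chain_incl _ (fun n x c hx _ h0 => le_trans (hg n x c h0) hx)
  have hR : ∀ (i j : ℤ) (hij : i ≤ j),
        IsChainMap (resD S d (offSubl S m A b g i)) (resD S d (offSubl S m A b g j))
          (resIncl S (P := offSubl S m A b g i) (Q := offSubl S m A b g j)
            (fun _ _ hx => ⟨hx.1, le_trans hx.2 hij⟩)) :=
    fun i j hij => chain_incl _ (fun n x c hx hc h0 => ⟨hc.1, le_trans (hg n x c h0) hx.2⟩)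
  have hQP : ∀ t n x, offSubl S m A b g t n x → subl S g t n x := fun t n x h => h.2
  have hcl : ∀ t n x c, subl S g t n x → d n (Finsupp.single x 1) c ≠ 0 →
      subl S g t (n-1) c := fun t n x c hx h0 => le_trans (hg n x c h0) hx
  have hC : ∀ t, IsChainMap (resD S d (subl S g t)) (resD S d (offSubl S m A b g t))
      (delt (subl S g t) (offSubl S m A b g t)) := by
    intro t
    refine chain_delt (hQP t) ?_
    intro n x c hx hnx hc
    have : ¬ offPair S m A b n x := fun h => hnx ⟨h, hx⟩
    simp only [offPair, ne_eq, not_and_or, not_not] at this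
    rcases this with h | h
    · cases h
      rw [hAb, Finsupp.single_apply_eq_zero]
      rintro rfl
      exact absurd rfl hc.1.2
    · cases h
      rw [hdb]; rfl
  have hB : ∀ t n, Function.Bijective (inducedHom (hC t) n) := by
    intro t
    refine inducedHom_bij ?_ (hC t) ?_ ?_
    · intro n x
      apply incl_inj
      rw [incl_resD (hcl t), incl_resD (hcl t), map_zero]
      exact LinearMap.ext_iff.mp (hd n) _
    · intro n x
      exact ⟨_, delt_incl (hQP t) n x⟩
    · intro n x hx hDx
      by_cases hx0 : x = 0
      · exact ⟨0, map_zero _, by rw [map_zero, hx0]⟩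
      have hz : ∀ c : {c : S (n-1) // subl S g t (n-1) c}, offPair S m A b (n-1) c.1 → x c = 0 := by
        intro c hc
        have := DFunLike.congr_fun hx ⟨c.1, hc, c.2⟩
        rwa [delt_apply, incl_apply _ _ _ c] at this
      obtain ⟨c, hc⟩ := DFunLike.ne_iff.mp hx0
      have hcp : ¬ offPair S m A b (n-1) c.1 := fun h => hc (hz c h)
      have hxs : ∀ a : S (n-1), a = c.1 → (∀ e, e ≠ a → offPair S m A b (n-1) e) →
          inclMap S (subl S g t) (n-1) x = Finsupp.single a 1 := by
        rintro a rfl he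
        rw [← incl_single _ _ c]
        congr 1
        ext e
        by_cases h : e = c
        · subst h
          rw [Finsupp.single_eq_same]
          exact zmod2_eq _ hc
        · rw [Finsupp.single_eq_of_ne h]
          exact hz e (he _ fun h' => h (Subtype.ext h'))
      have hDx' := congrArg (inclMap S (subl S g t) _) hDx
      rw [incl_resD (hcl t), map_zero] at hDx'
      simp only [offPair, ne_eq, not_and_or, not_not] at hcp
      obtain ⟨c, hct⟩ := c
      rcases hcp with h | h
      · exfalso
        obtain ⟨h1, h2⟩ := Sigma.mk.inj h
        subst h1
        have h2 := eq_of_heq h2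
        simp only at h2
        subst h2
        rw [hxs c rfl ?_, hAb] at hDx'
        · simp at hDx'
        · intro e he
          refine ⟨fun h => he (by simpa using h), fun h => ?_⟩
          have := (Sigma.mk.inj h).1
          omega
      · obtain ⟨h1, h2⟩ := Sigma.mk.inj h
        obtain rfl : n = m := by omega
        have h2 := eq_of_heq h2
        simp only at h2
        subst h2
        have hAt : subl S g t n A := by
          have : g (n-1) c ≤ t := hct
          show g n A ≤ t
          omega
        refine ⟨Finsupp.single ⟨A, hAt⟩ 1, delt_single_not _ _ fun h => h.1.1 rfl, ?_⟩
        apply incl_inj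
        rw [incl_resD (hcl t), incl_single, hAb, hxs c rfl]
        intro e he
        refine ⟨fun h => ?_, fun h => he (by simpa using h)⟩
        have := (Sigma.mk.inj h).1
        omega
  refine ⟨hK, hR, fun n i j hij => ?_⟩
  refine range_equiv _ _ _ _ (hB i n) (hB j n) ?_
  intro q
  obtain ⟨⟨x, hx⟩, rfl⟩ := Submodule.Quotient.mk_surjective _ q
  show (Submodule.Quotient.mk (cyclesMap (hC j) n (cyclesMap (hK i j hij) n ⟨x, hx⟩)) :
    homology _ (resD S d (offSubl S m A b g j)) n) =
    Submodule.Quotient.mk (cyclesMap (hR i j hij) n (cyclesMap (hC i) n ⟨x, hx⟩))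
  congr 1
  apply Subtype.ext
  exact delt_comm (P := subl S g i) (P' := subl S g j) (Q := offSubl S m A b g i)
    (Q' := offSubl S m A b g j) (fun _ _ hx => le_trans hx hij)
    (fun _ _ hx => ⟨hx.1, le_trans hx.2 hij⟩) (fun n c h => h.2) (fun n c h h' => ⟨h.1, h'⟩) n x
end

section
/- Acyclic subspace method preserves positive-degree persistent homology: Let g be a filtration of the cellular chain complex K, and let T be a closed subset of the cells. For t ∈ ℤ let T_t be the cells of T of g-value ≤ t and let A_t denote the subcomplex of chains supported on T_t inside the sublevel complex K_t. Assume that for every t: A_t has trivial homology in every degree n ≥ 1, and the map induced on degree-0 homology by the inclusion A_t → K_t is injective. Then for every degree n ≥ 1 and all i ≤ j, the degree-n persistent homology H_n^{i,j} of the filtered complex K is isomorphic as a ZMod 2-module to the degree-n persistent homology H_n^{i,j} of the filtered complement complex on S∖T (whose level-t complex is the complement complex of T_t in K_t, filtered by the restriction of g). -/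
section AcyclicHelpers

theorem mem_bdries_aux (M : ℤ → Type) [∀ n, AddCommGroup (M n)] [∀ n, Module (ZMod 2) (M n)]
    (D : ∀ n : ℤ, M n →ₗ[ZMod 2] M (n-1)) {n k : ℤ} (h : k + 1 = n) (h' : n - 1 = k) (x : M k) :
    x ∈ bdries M D k ↔ ∃ c : M n, mcast M h' (D n c) = x := by
  subst h
  constructor
  · rintro ⟨y, ⟨c, rfl⟩, rfl⟩
    exact ⟨c, rfl⟩
  · rintro ⟨c, rfl⟩
    exact ⟨_, ⟨c, rfl⟩, rfl⟩

theorem mem_bdries_pred (M : ℤ → Type) [∀ n, AddCommGroup (M n)] [∀ n, Module (ZMod 2) (M n)]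
    (D : ∀ n : ℤ, M n →ₗ[ZMod 2] M (n-1)) (n : ℤ) (x : M (n-1)) :
    x ∈ bdries M D (n-1) ↔ ∃ c : M n, D n c = x :=
  mem_bdries_aux M D (by ring) rfl x

theorem mem_bdries_succ (M : ℤ → Type) [∀ n, AddCommGroup (M n)] [∀ n, Module (ZMod 2) (M n)]
    (D : ∀ n : ℤ, M n →ₗ[ZMod 2] M (n-1)) (n : ℤ) (x : M n) :
    x ∈ bdries M D n ↔
      ∃ c : M (n+1), mcast M (show n+1-1 = n by ring) (D (n+1) c) = x :=
  mem_bdries_aux M D rfl _ x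

theorem mem_bdries_of_subsingleton (M : ℤ → Type) [∀ n, AddCommGroup (M n)]
    [∀ n, Module (ZMod 2) (M n)]
    (D : ∀ n : ℤ, M n →ₗ[ZMod 2] M (n-1)) (n : ℤ) (h : Subsingleton (homology M D n))
    (x : M n) (hx : D n x = 0) : x ∈ bdries M D n := by
  have h1 : (Submodule.Quotient.mk ⟨x, hx⟩ : homology M D n) = 0 := Subsingleton.elim _ _
  rw [Submodule.Quotient.mk_eq_zero] at h1
  exact h1

theorem mem_bdries_of_injective {M M' : ℤ → Type} [∀ n, AddCommGroup (M n)]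
    [∀ n, Module (ZMod 2) (M n)] [∀ n, AddCommGroup (M' n)] [∀ n, Module (ZMod 2) (M' n)]
    {D : ∀ n : ℤ, M n →ₗ[ZMod 2] M (n-1)} {D' : ∀ n : ℤ, M' n →ₗ[ZMod 2] M' (n-1)}
    {f : ∀ n, M n →ₗ[ZMod 2] M' n} (hf : IsChainMap D D' f) (n : ℤ)
    (h : Function.Injective (inducedHom hf n))
    (x : M n) (hx : D n x = 0) (hb : f n x ∈ bdries M' D' n) : x ∈ bdries M D n := by
  have h1 : (Submodule.Quotient.mk ⟨x, hx⟩ : homology M D n) = 0 := by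
    apply h
    rw [map_zero]
    refine (Submodule.Quotient.mk_eq_zero _).2 ?_
    exact hb
  rw [Submodule.Quotient.mk_eq_zero] at h1
  exact h1

theorem inducedHom_bijective_of_exact {A K C : ℤ → Type}
    [∀ n, AddCommGroup (A n)] [∀ n, Module (ZMod 2) (A n)]
    [∀ n, AddCommGroup (K n)] [∀ n, Module (ZMod 2) (K n)]
    [∀ n, AddCommGroup (C n)] [∀ n, Module (ZMod 2) (C n)]
    {DA : ∀ n : ℤ, A n →ₗ[ZMod 2] A (n-1)} {DK : ∀ n : ℤ, K n →ₗ[ZMod 2] K (n-1)}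
    {DC : ∀ n : ℤ, C n →ₗ[ZMod 2] C (n-1)}
    {f : ∀ n, A n →ₗ[ZMod 2] K n} (hf : IsChainMap DA DK f)
    {p : ∀ n, K n →ₗ[ZMod 2] C n} (hp : IsChainMap DK DC p)
    (hfi : ∀ n, Function.Injective (f n)) (hps : ∀ n, Function.Surjective (p n))
    (hex : ∀ n z, p n z = 0 → ∃ a, f n a = z)
    (hpf : ∀ n a, p n (f n a) = 0)
    (hdd : ∀ n z, DK (n-1) (DK n z) = 0)
    (hac : ∀ n, 1 ≤ n → Subsingleton (homology A DA n))
    (hinj : Function.Injective (inducedHom hf 0)) (n : ℤ) (hn : 1 ≤ n) :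
    Function.Bijective (inducedHom hp n) := by
  have hf' : ∀ n x, DK n (f n x) = f (n-1) (DA n x) := fun n x => LinearMap.congr_fun (hf n) x
  have hp' : ∀ n x, DC n (p n x) = p (n-1) (DK n x) := fun n x => LinearMap.congr_fun (hp n) x
  constructor
  · rw [injective_iff_map_eq_zero]
    intro q hq
    obtain ⟨⟨z, hz⟩, rfl⟩ := Submodule.Quotient.mk_surjective _ q
    have hb : p n z ∈ bdries C DC n := by
      have hq' : (Submodule.Quotient.mk (cyclesMap hp n ⟨z, hz⟩) : homology C DC n) = 0 := hq
      rw [Submodule.Quotient.mk_eq_zero] at hq'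
      exact hq'
    refine (Submodule.Quotient.mk_eq_zero _).2 ?_
    show z ∈ bdries K DK n
    obtain ⟨c, hc⟩ := (mem_bdries_succ _ _ _ _).1 hb
    obtain ⟨w, rfl⟩ := hps _ c
    rw [hp', ← mcast_comm K C p] at hc
    set y := mcast K (show n+1-1 = n by ring) (DK (n+1) w) with hy
    have hyb : y ∈ bdries K DK n := (mem_bdries_succ _ _ _ _).2 ⟨w, rfl⟩
    have hyz : DK n y = 0 := by
      have key : ∀ (m : ℤ) (h : n + 1 - 1 = m),
          DK m (mcast K h (DK (n+1) w)) = 0 := by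
        intro m h
        subst h
        exact hdd (n+1) w
      exact key n _
    obtain ⟨a, ha⟩ := hex n (z - y) (by rw [map_sub, hc, sub_self])
    have haz : DA n a = 0 := by
      apply hfi
      rw [← hf', ha, map_sub, hyz, map_zero]
      have : DK n z = 0 := hz
      rw [this, sub_zero]
    obtain ⟨b, hb⟩ := (mem_bdries_succ _ _ _ _).1
      (mem_bdries_of_subsingleton A DA n (hac n hn) a haz)
    have hfa : f n a ∈ bdries K DK n := by
      refine (mem_bdries_succ _ _ _ _).2 ⟨f (n+1) b, ?_⟩
      rw [hf', ← mcast_comm A K f, hb]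
    have : z = f n a + y := by rw [ha]; abel
    rw [this]
    exact add_mem hfa hyb
  · intro q
    obtain ⟨⟨z, hz⟩, rfl⟩ := Submodule.Quotient.mk_surjective _ q
    have hz : DC n z = 0 := hz
    obtain ⟨w, rfl⟩ := hps _ z
    rw [hp'] at hz
    obtain ⟨a, ha⟩ := hex _ _ hz
    have haz : DA (n-1) a = 0 := by
      apply hfi
      rw [← hf', ha, map_zero, hdd]
    have hab : a ∈ bdries A DA (n-1) := by
      by_cases h1 : n = 1
      · subst h1
        refine mem_bdries_of_injective hf (1-1) ?_ a haz ?_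
        · exact hinj
        · exact (mem_bdries_pred _ _ _ _).2 ⟨w, ha.symm⟩
      · exact mem_bdries_of_subsingleton A DA (n-1) (hac _ (by omega)) a haz
    obtain ⟨b, rfl⟩ := (mem_bdries_pred _ _ _ _).1 hab
    refine ⟨Submodule.Quotient.mk ⟨w - f n b, ?_⟩, ?_⟩
    · show DK n _ = 0
      rw [map_sub, hf', ha, sub_self]
    · show Submodule.Quotient.mk _ = _
      congr 1
      apply Subtype.ext
      show p n (w - f n b) = p n w
      rw [map_sub, hpf, sub_zero]

theorem range_equiv_of_square {X Y X' Y' : Type} [AddCommGroup X] [AddCommGroup Y]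
    [AddCommGroup X'] [AddCommGroup Y'] [Module (ZMod 2) X] [Module (ZMod 2) Y]
    [Module (ZMod 2) X'] [Module (ZMod 2) Y'] (f : X →ₗ[ZMod 2] Y) (f' : X' →ₗ[ZMod 2] Y')
    (e : X →ₗ[ZMod 2] X') (e' : Y →ₗ[ZMod 2] Y') (he : Function.Bijective e)
    (he' : Function.Bijective e') (h : ∀ x, e' (f x) = f' (e x)) :
    Nonempty (LinearMap.range f ≃ₗ[ZMod 2] LinearMap.range f') := by
  have hr : (LinearMap.range f).map (LinearEquiv.ofBijective e' he').toLinearMap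
      = LinearMap.range f' := by
    ext y
    constructor
    · rintro ⟨_, ⟨x, rfl⟩, rfl⟩
      exact ⟨e x, (h x).symm⟩
    · rintro ⟨x, rfl⟩
      obtain ⟨x, rfl⟩ := he.2 x
      exact ⟨f x, ⟨x, rfl⟩, h x⟩
  exact ⟨((LinearEquiv.ofBijective e' he').submoduleMap _).trans (LinearEquiv.ofEq _ _ hr)⟩

/-- Deletion between restricted complexes. -/
noncomputable def resProj (S : ℤ → Type) {R Q : ∀ n : ℤ, S n → Prop} (h : ∀ n x, R n x → Q n x)
    (n : ℤ) : rCh S Q n →ₗ[ZMod 2] rCh S R n :=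
  Finsupp.lcomapDomain (fun x : {x : S n // R n x} => (⟨x.1, h n x.1 x.2⟩ : {x : S n // Q n x}))
    (fun x y hxy => Subtype.ext (by have h0 := congrArg Subtype.val hxy; exact h0))

theorem resProj_apply (S : ℤ → Type) {R Q : ∀ n : ℤ, S n → Prop} (h : ∀ n x, R n x → Q n x)
    (n : ℤ) (v : rCh S Q n) (x : {x : S n // R n x}) :
    resProj S h n v x = v ⟨x.1, h n x.1 x.2⟩ := rfl

theorem resIncl_apply_pos (S : ℤ → Type) {P Q : ∀ n : ℤ, S n → Prop} (h : ∀ n x, P n x → Q n x)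
    (n : ℤ) (v : rCh S P n) (x : S n) (hx : P n x) (hx' : Q n x) :
    resIncl S h n v ⟨x, hx'⟩ = v ⟨x, hx⟩ :=
  Finsupp.mapDomain_apply (f := fun x : {x : S n // P n x} =>
      (⟨x.1, h n x.1 x.2⟩ : {x : S n // Q n x}))
    (fun x y hxy => Subtype.ext (by have h0 := congrArg Subtype.val hxy; exact h0)) v ⟨x, hx⟩

theorem resIncl_apply_neg (S : ℤ → Type) {P Q : ∀ n : ℤ, S n → Prop} (h : ∀ n x, P n x → Q n x)
    (n : ℤ) (v : rCh S P n) (x : S n) (hx : ¬ P n x) (hx' : Q n x) :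
    resIncl S h n v ⟨x, hx'⟩ = 0 := by
  apply Finsupp.mapDomain_of_notMem_range
  rintro ⟨y, hy⟩
  have : y.1 = x := congrArg Subtype.val hy
  exact hx (this ▸ y.2)

theorem resD_single (S : ℤ → Type)
    (d : ∀ n : ℤ, (S n →₀ ZMod 2) →ₗ[ZMod 2] (S (n-1) →₀ ZMod 2))
    (P : ∀ n : ℤ, S n → Prop) (n : ℤ) (a : {x : S n // P n x}) (c : {x : S (n-1) // P (n-1) x}) :
    resD S d P n (Finsupp.single a 1) c = d n (Finsupp.single a.1 1) c.1 := by
  show d n (Finsupp.mapDomain Subtype.val (Finsupp.single a 1)) c.1 = _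
  rw [Finsupp.mapDomain_single]

theorem resIncl_single (S : ℤ → Type) {P Q : ∀ n : ℤ, S n → Prop} (h : ∀ n x, P n x → Q n x)
    (n : ℤ) (a : {x : S n // P n x}) :
    resIncl S h n (Finsupp.single a 1) = Finsupp.single ⟨a.1, h n a.1 a.2⟩ 1 :=
  Finsupp.mapDomain_single

theorem resIncl_isChainMap (S : ℤ → Type)
    (d : ∀ n : ℤ, (S n →₀ ZMod 2) →ₗ[ZMod 2] (S (n-1) →₀ ZMod 2))
    {P Q : ∀ n : ℤ, S n → Prop} (h : ∀ n x, P n x → Q n x)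
    (hc : ∀ n a c, P n a → Q (n-1) c → d n (Finsupp.single a 1) c ≠ 0 → P (n-1) c) :
    IsChainMap (resD S d P) (resD S d Q) (resIncl S h) := by
  intro n
  refine Finsupp.lhom_ext' fun a => LinearMap.ext_ring ?_
  refine Finsupp.ext fun c => ?_
  show resD S d Q n (resIncl S h n (Finsupp.single a 1)) c =
    resIncl S h (n-1) (resD S d P n (Finsupp.single a 1)) c
  rw [resIncl_single, resD_single]
  obtain ⟨c, hcq⟩ := c
  by_cases hp : P (n-1) c
  · rw [resIncl_apply_pos S h (n-1) _ c hp hcq, resD_single]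
  · rw [resIncl_apply_neg S h (n-1) _ c hp hcq]
    by_contra hne
    exact hp (hc n a.1 c a.2 hcq hne)

theorem resProj_isChainMap (S : ℤ → Type)
    (d : ∀ n : ℤ, (S n →₀ ZMod 2) →ₗ[ZMod 2] (S (n-1) →₀ ZMod 2))
    {R Q : ∀ n : ℤ, S n → Prop} (h : ∀ n x, R n x → Q n x)
    (hc : ∀ n a c, Q n a → R (n-1) c → d n (Finsupp.single a 1) c ≠ 0 → R n a) :
    IsChainMap (resD S d Q) (resD S d R) (resProj S h) := by
  intro n
  refine Finsupp.lhom_ext' fun a => LinearMap.ext_ring ?_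
  refine Finsupp.ext fun c => ?_
  show resD S d R n (resProj S h n (Finsupp.single a 1)) c =
    resProj S h (n-1) (resD S d Q n (Finsupp.single a 1)) c
  rw [resProj_apply, resD_single]
  obtain ⟨a, ha⟩ := a
  by_cases hr : R n a
  · have : resProj S h n (Finsupp.single ⟨a, ha⟩ 1) = Finsupp.single ⟨a, hr⟩ 1 := by
      classical
      refine Finsupp.ext fun x => ?_
      rw [resProj_apply, Finsupp.single_apply, Finsupp.single_apply]
      simp only [Subtype.ext_iff]
    rw [this, resD_single]
  · have : resProj S h n (Finsupp.single ⟨a, ha⟩ 1) = 0 := by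
      classical
      refine Finsupp.ext fun x => ?_
      rw [resProj_apply, Finsupp.single_apply, if_neg]
      · rfl
      · intro hx
        have : a = x.1 := congrArg Subtype.val hx
        exact hr (this ▸ x.2)
    rw [this, map_zero]
    by_contra hne
    exact hr (hc n a c.1 ha c.2 (fun h0 => hne h0.symm))

theorem resD_resD (S : ℤ → Type)
    (d : ∀ n : ℤ, (S n →₀ ZMod 2) →ₗ[ZMod 2] (S (n-1) →₀ ZMod 2))
    (hd : ∀ n : ℤ, (d (n-1)).comp (d n) = 0)
    {P : ∀ n : ℤ, S n → Prop}
    (hc : ∀ n a c, P n a → d n (Finsupp.single a 1) c ≠ 0 → P (n-1) c) (n : ℤ) (z : rCh S P n) :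
    resD S d P (n-1) (resD S d P n z) = 0 := by
  have key : ∀ n, (inclMap S P (n-1)).comp (resD S d P n) = (d n).comp (inclMap S P n) := by
    intro n
    refine Finsupp.lhom_ext' fun a => LinearMap.ext_ring ?_
    refine Finsupp.ext fun c => ?_
    show Finsupp.mapDomain Subtype.val (resD S d P n (Finsupp.single a 1)) c =
      d n (Finsupp.mapDomain Subtype.val (Finsupp.single a 1)) c
    rw [Finsupp.mapDomain_single]
    by_cases hp : P (n-1) c
    · refine (Finsupp.mapDomain_apply Subtype.val_injective _
        (⟨c, hp⟩ : {x : S (n-1) // P (n-1) x})).trans ?_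
      rw [resD_single]
    · rw [Finsupp.mapDomain_of_notMem_range]
      · by_contra hne
        exact hp (hc n a.1 c a.2 (fun h0 => hne h0.symm))
      · rintro ⟨y, hy⟩
        exact hp (hy ▸ y.2)
  have hi : Function.Injective (inclMap S P (n-1-1)) :=
    Finsupp.mapDomain_injective Subtype.val_injective
  apply hi
  have k1 := LinearMap.congr_fun (key (n-1)) (resD S d P n z)
  have k2 := LinearMap.congr_fun (key n) z
  simp only [LinearMap.comp_apply] at k1 k2
  rw [k1, k2, map_zero]
  exact LinearMap.congr_fun (hd n) _

end AcyclicHelpers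

/-- Acyclic subspace method preserves positive-degree persistent homology: if `T` is a closed
set of cells such that each `A_t` (the subcomplex of chains supported on the cells of `T` of
`g`-value `≤ t`) is acyclic in degrees `≥ 1` and injects on degree-0 homology into `K_t`, then
the persistent homology of `K` agrees with that of the filtered complement complex on `S∖T` in
every degree `n ≥ 1`. -/
theorem acyclic_subspace_persistence
    (S : ℤ → Type)
    (d : ∀ n : ℤ, (S n →₀ ZMod 2) →ₗ[ZMod 2] (S (n-1) →₀ ZMod 2))
    (hd : ∀ n : ℤ, (d (n-1)).comp (d n) = 0)
    (g : ∀ n : ℤ, S n → ℤ)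
    (hg : ∀ (n : ℤ) (a : S n) (c : S (n-1)),
      (d n (Finsupp.single a 1)) c ≠ 0 → g (n-1) c ≤ g n a)
    (T : ∀ n : ℤ, S n → Prop)
    (hT : ∀ (n : ℤ) (t : S n), T n t →
      ∀ c : S (n-1), (d n (Finsupp.single t 1)) c ≠ 0 → T (n-1) c)
    (hacyclic : ∀ t : ℤ, ∀ n : ℤ, 1 ≤ n →
      Subsingleton (homology _ (resD S d (fun k x => T k x ∧ g k x ≤ t)) n))
    (hinj : ∀ t : ℤ,
      ∀ hcm : IsChainMap (resD S d (fun k x => T k x ∧ g k x ≤ t)) (resD S d (subl S g t))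
        (resIncl S (P := fun k x => T k x ∧ g k x ≤ t) (Q := subl S g t)
          (fun _ _ hx => hx.2)),
      Function.Injective (inducedHom hcm 0)) :
    ∃ (hK : ∀ (i j : ℤ) (hij : i ≤ j),
        IsChainMap (resD S d (subl S g i)) (resD S d (subl S g j))
          (resIncl S (P := subl S g i) (Q := subl S g j) (fun _ _ hx => le_trans hx hij)))
      (hC : ∀ (i j : ℤ) (hij : i ≤ j),
        IsChainMap (resD S d (fun k x => ¬ T k x ∧ g k x ≤ i))
          (resD S d (fun k x => ¬ T k x ∧ g k x ≤ j))
          (resIncl S (P := fun k x => ¬ T k x ∧ g k x ≤ i)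
            (Q := fun k x => ¬ T k x ∧ g k x ≤ j)
            (fun _ _ hx => ⟨hx.1, le_trans hx.2 hij⟩))),
      ∀ n : ℤ, 1 ≤ n → ∀ (i j : ℤ) (hij : i ≤ j),
        Nonempty ((LinearMap.range (inducedHom (hK i j hij) n)) ≃ₗ[ZMod 2]
          (LinearMap.range (inducedHom (hC i j hij) n))) := by
  have hclK : ∀ t n a c, subl S g t n a → d n (Finsupp.single a 1) c ≠ 0 → subl S g t (n-1) c :=
    fun t n a c ha h => le_trans (hg n a c h) ha
  have hK : ∀ (i j : ℤ) (hij : i ≤ j),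
        IsChainMap (resD S d (subl S g i)) (resD S d (subl S g j))
          (resIncl S (P := subl S g i) (Q := subl S g j) (fun _ _ hx => le_trans hx hij)) :=
    fun i j hij => resIncl_isChainMap S d _ (fun n a c ha _ h => hclK i n a c ha h)
  have hC : ∀ (i j : ℤ) (hij : i ≤ j),
        IsChainMap (resD S d (fun k x => ¬ T k x ∧ g k x ≤ i))
          (resD S d (fun k x => ¬ T k x ∧ g k x ≤ j))
          (resIncl S (P := fun k x => ¬ T k x ∧ g k x ≤ i)
            (Q := fun k x => ¬ T k x ∧ g k x ≤ j)
            (fun _ _ hx => ⟨hx.1, le_trans hx.2 hij⟩)) :=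
    fun i j hij => resIncl_isChainMap S d _
      (fun n a c ha hc h => ⟨hc.1, le_trans (hg n a c h) ha.2⟩)
  have hA : ∀ t, IsChainMap (resD S d (fun k x => T k x ∧ g k x ≤ t)) (resD S d (subl S g t))
        (resIncl S (P := fun k x => T k x ∧ g k x ≤ t) (Q := subl S g t)
          (fun _ _ hx => hx.2)) :=
    fun t => resIncl_isChainMap S d _
      (fun n a c ha hc h => ⟨hT n a ha.1 c h, le_trans (hg n a c h) ha.2⟩)
  have hP : ∀ t, IsChainMap (resD S d (subl S g t)) (resD S d (fun k x => ¬ T k x ∧ g k x ≤ t))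
        (resProj S (R := fun k x => ¬ T k x ∧ g k x ≤ t) (Q := subl S g t)
          (fun _ _ hx => hx.2)) :=
    fun t => resProj_isChainMap S d _
      (fun n a c ha hc h => ⟨fun hTa => hc.1 (hT n a hTa c h), ha⟩)
  have hbij : ∀ t n, 1 ≤ n → Function.Bijective (inducedHom (hP t) n) := by
    intro t n hn
    refine inducedHom_bijective_of_exact (hA t) (hP t) ?_ ?_ ?_ ?_
      (resD_resD S d hd (hclK t)) (hacyclic t) (hinj t (hA t)) n hn
    · intro n
      exact Finsupp.mapDomain_injective
        (fun x y hxy => Subtype.ext (by have h0 := congrArg Subtype.val hxy; exact h0))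
    · intro n z
      refine ⟨resIncl S (P := fun k x => ¬ T k x ∧ g k x ≤ t) (Q := subl S g t)
          (fun _ _ hx => hx.2) n z, ?_⟩
      refine Finsupp.ext fun x => ?_
      refine (resProj_apply S (R := fun k x => ¬ T k x ∧ g k x ≤ t)
        (Q := subl S g t) _ n _ x).trans ?_
      exact resIncl_apply_pos S _ n z x.1 x.2 _
    · intro n z hz
      refine ⟨resProj S (R := fun k x => T k x ∧ g k x ≤ t) (Q := subl S g t)
          (fun _ _ hx => hx.2) n z, ?_⟩
      refine Finsupp.ext fun x => ?_
      obtain ⟨x, hx⟩ := x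
      by_cases hTx : T n x
      · exact resIncl_apply_pos S _ n _ x ⟨hTx, hx⟩ _
      · refine (resIncl_apply_neg S _ n _ x (fun h => hTx h.1) _).trans ?_
        exact (DFunLike.congr_fun hz ⟨x, hTx, hx⟩).symm
    · intro n a
      refine Finsupp.ext fun x => ?_
      refine (resProj_apply S (R := fun k x => ¬ T k x ∧ g k x ≤ t)
        (Q := subl S g t) _ n _ x).trans ?_
      exact resIncl_apply_neg S _ n _ x.1 (fun h => x.2.1 h.1) _
  refine ⟨hK, hC, fun n hn i j hij => ?_⟩
  refine range_equiv_of_square _ _ (inducedHom (hP i) n) (inducedHom (hP j) n)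
    (hbij i n hn) (hbij j n hn) ?_
  intro q
  obtain ⟨z, rfl⟩ := Submodule.Quotient.mk_surjective _ q
  show Submodule.Quotient.mk _ = Submodule.Quotient.mk _
  congr 1
  apply Subtype.ext
  refine Finsupp.ext fun x => ?_
  obtain ⟨x, hx⟩ := x
  show resIncl S (P := subl S g i) (Q := subl S g j) (fun _ _ hx => le_trans hx hij) n z.1
      ⟨x, hx.2⟩ = resIncl S (P := fun k x => ¬ T k x ∧ g k x ≤ i)
            (Q := fun k x => ¬ T k x ∧ g k x ≤ j)
            (fun _ _ hx => ⟨hx.1, le_trans hx.2 hij⟩) n (resProj S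
            (R := fun k x => ¬ T k x ∧ g k x ≤ i) (Q := subl S g i)
          (fun _ _ hx => hx.2) n z.1) ⟨x, hx⟩
  by_cases hxi : g n x ≤ i
  · refine (resIncl_apply_pos S _ n _ x hxi _).trans ?_
    refine Eq.trans ?_ (resIncl_apply_pos S (P := fun k x => ¬ T k x ∧ g k x ≤ i)
            (Q := fun k x => ¬ T k x ∧ g k x ≤ j) _ n _ x ⟨hx.1, hxi⟩ hx).symm
    rfl
  · refine (resIncl_apply_neg S _ n _ x hxi _).trans ?_
    exact (resIncl_apply_neg S _ n _ x (fun h => hxi h.2) _).symm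
end
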